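/- Gradient bound for minimizers: let v_eps be global minimizers of J_eps (with delta > 0 sufficiently small). Then there exists a constant C > 0 independent of eps such that |v_eps'(t)| <= C / eps for all t in I and all eps > 0 sufficiently small. -/

import Mathlib

open MeasureTheory Set Filter Topology Asymptotics
open scoped ENNReal Classical

noncomputable section

/-- The double-well potential hypotheses \eqref{W_Smooth}-\eqref{WGurtin_Assumption}:
`W ≥ 0` is `C²` away from its two zeros `a < b`, the second derivative behaves like
`l * |s - a|^(q-1)` (resp. `l * |s - b|^(q-1)`) near the wells, `W'` has exactly the
three zeros `a < c < b` with `W'' (c) < 0`, and `|W'|` stays bounded away from `0`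
at infinity. -/
structure DoubleWell (W : ℝ → ℝ) (a b c q l : ℝ) : Prop where
  lt_ab : a < b
  lt_ac : a < c
  lt_cb : c < b
  nonneg : ∀ s, 0 ≤ W s
  smooth : ContDiffOn ℝ 2 W (({a, b} : Set ℝ)ᶜ)
  zeros : ∀ s, W s = 0 ↔ s = a ∨ s = b
  q_mem : q ∈ Set.Ioc (0 : ℝ) 1
  l_pos : 0 < l
  lim_a : Filter.Tendsto (fun s => deriv (deriv W) s / |s - a| ^ (q - 1)) (𝓝[≠] a) (𝓝 l)
  lim_b : Filter.Tendsto (fun s => deriv (deriv W) s / |s - b| ^ (q - 1)) (𝓝[≠] b) (𝓝 l)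
  deriv_zeros : ∀ s, deriv W s = 0 ↔ s = a ∨ s = c ∨ s = b
  concave_c : deriv (deriv W) c < 0
  coercive : ∃ L > 0, ∃ R : ℝ, ∀ s : ℝ, R ≤ |s| → L ≤ |deriv W s|

/-- The hypotheses \eqref{etaSmooth}-\eqref{etaPrimeRatio} on the weight `η` on
`I = (-T,T)`: positivity, `C^{1,β}` regularity, power-like behaviour
`(t+T)^(n₁-1)` resp. `(T-t)^(n₂-1)` at the two endpoints, and the bound
`|η'| ≤ d₅ η / min{T-t, t+T}`. -/
structure GoodWeight (T : ℝ) (η : ℝ → ℝ) (β : ℝ) (n₁ n₂ : ℕ)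
    (d₁ d₂ d₃ d₄ d₅ tstar : ℝ) : Prop where
  pos : ∀ t ∈ Set.Ioo (-T) T, 0 < η t
  integrable : MeasureTheory.IntegrableOn η (Set.Ioo (-T) T)
  beta_mem : β ∈ Set.Ioc (0 : ℝ) 1
  smooth : ContDiffOn ℝ 1 η (Set.Ioo (-T) T)
  holder : ∀ K : Set ℝ, K ⊆ Set.Ioo (-T) T → IsCompact K →
    ∃ C : ℝ, ∀ x ∈ K, ∀ y ∈ K, |deriv η x - deriv η y| ≤ C * |x - y| ^ β
  n₁_pos : 1 ≤ n₁
  n₂_pos : 1 ≤ n₂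
  d₁_pos : 0 < d₁
  d₂_pos : 0 < d₂
  d₃_pos : 0 < d₃
  d₄_pos : 0 < d₄
  d₅_pos : 0 < d₅
  tstar_mem : tstar ∈ Set.Ioo (0 : ℝ) T
  tail₁ : ∀ t ∈ Set.Ioc (-T) (-T + tstar),
    d₁ * (t + T) ^ (n₁ - 1) ≤ η t ∧ η t ≤ d₂ * (t + T) ^ (n₁ - 1)
  tail₂ : ∀ t ∈ Set.Ico (T - tstar) T,
    d₃ * (T - t) ^ (n₂ - 1) ≤ η t ∧ η t ≤ d₄ * (T - t) ^ (n₂ - 1)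
  deriv_bound : ∀ t ∈ Set.Ioo (-T) T, |deriv η t| ≤ d₅ * η t / min (T - t) (t + T)

/-- The heteroclinic profile: solution of `z' = √(W ∘ z)`, `z 0 = c`, `z ∈ [a,b]`. -/
structure CauchyProfile (W : ℝ → ℝ) (a b c : ℝ) (z : ℝ → ℝ) : Prop where
  ode : ∀ t, HasDerivAt z (Real.sqrt (W (z t))) t
  init : z 0 = c
  range : ∀ t, z t ∈ Set.Icc a b

/-- The weighted `L¹` distance on `(-T,T)`. -/
def dist1 (T : ℝ) (η v w : ℝ → ℝ) : ℝ :=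
  ∫ t in Set.Ioo (-T) T, |v t - w t| * η t

/-- Membership in the weighted space `H¹_η`. -/
def MemH1 (T : ℝ) (η v : ℝ → ℝ) : Prop :=
  (∀ t ∈ Set.Ioo (-T) T, DifferentiableAt ℝ v t) ∧
  MeasureTheory.IntegrableOn (fun t => ((v t) ^ 2 + (deriv v t) ^ 2) * η t) (Set.Ioo (-T) T)

/-- Membership in the weighted space `L¹_η`. -/
def MemL1 (T : ℝ) (η v : ℝ → ℝ) : Prop :=
  MeasureTheory.IntegrableOn (fun t => |v t| * η t) (Set.Ioo (-T) T)

/-- The mass constraint `∫_I v η dt = m`. -/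
def massEq (T : ℝ) (η : ℝ → ℝ) (m : ℝ) (v : ℝ → ℝ) : Prop :=
  (∫ t in Set.Ioo (-T) T, v t * η t) = m

/-- The weighted Cahn–Hilliard energy `∫_I (W(v) + ε² v'²) η dt` (real-valued). -/
def energy (T : ℝ) (W η : ℝ → ℝ) (ε : ℝ) (v : ℝ → ℝ) : ℝ :=
  ∫ t in Set.Ioo (-T) T, (W (v t) + ε ^ 2 * (deriv v t) ^ 2) * η t

/-- The rescaled energy `G_ε^{(1)}(v) = ∫_I (W(v)/ε + ε v'²) η dt` (real-valued). -/
def energy1 (T : ℝ) (W η : ℝ → ℝ) (ε : ℝ) (v : ℝ → ℝ) : ℝ :=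
  ∫ t in Set.Ioo (-T) T, (W (v t) / ε + ε * (deriv v t) ^ 2) * η t

/-- The weighted energy as an extended-real-valued integral. -/
def ennEnergy (T : ℝ) (W η : ℝ → ℝ) (ε : ℝ) (v : ℝ → ℝ) : ℝ≥0∞ :=
  ∫⁻ t in Set.Ioo (-T) T, ENNReal.ofReal ((W (v t) + ε ^ 2 * (deriv v t) ^ 2) * η t)

/-- The functional `G_ε` on `L¹_η` : the energy if `v ∈ H¹_η` satisfies the
mass constraint, `+∞` otherwise. -/
def GepsE (T : ℝ) (W η : ℝ → ℝ) (m ε : ℝ) (v : ℝ → ℝ) : ℝ≥0∞ :=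
  if MemH1 T η v ∧ massEq T η m v then ennEnergy T W η ε v else ⊤

/-- The functional `G_ε^{(1)} = G_ε / ε` on `L¹_η`. -/
def Geps1E (T : ℝ) (W η : ℝ → ℝ) (m ε : ℝ) (v : ℝ → ℝ) : ℝ≥0∞ :=
  if MemH1 T η v ∧ massEq T η m v then
    ∫⁻ t in Set.Ioo (-T) T, ENNReal.ofReal ((W (v t) / ε + ε * (deriv v t) ^ 2) * η t)
  else ⊤

/-- The zeroth order Γ-limit `G⁽⁰⁾`. -/
def G0E (T : ℝ) (W η : ℝ → ℝ) (m : ℝ) (v : ℝ → ℝ) : ℝ≥0∞ :=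
  if MemL1 T η v ∧ massEq T η m v then
    ∫⁻ t in Set.Ioo (-T) T, ENNReal.ofReal (W (v t) * η t)
  else ⊤

/-- The set of values whose supremum is the weighted total variation
`∫_I η d|Dv| = sup { ∫_I v φ' dt : φ ∈ C¹_c(I), |φ| ≤ η }`. -/
def wTVvals (T : ℝ) (η v : ℝ → ℝ) : Set ℝ :=
  { r | ∃ φ : ℝ → ℝ, ContDiff ℝ 1 φ ∧ HasCompactSupport φ ∧
      tsupport φ ⊆ Set.Ioo (-T) T ∧ (∀ t ∈ Set.Ioo (-T) T, |φ t| ≤ η t) ∧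
      r = ∫ t in Set.Ioo (-T) T, v t * deriv φ t }

/-- The weighted total variation `∫_I η d|Dv|`. -/
def wTV (T : ℝ) (η v : ℝ → ℝ) : ℝ := sSup (wTVvals T η v)

/-- The class `𝒞` of `BV_η` functions with values in `{a,b}` satisfying the mass
constraint. -/
def memC (T : ℝ) (η : ℝ → ℝ) (a b m : ℝ) (v : ℝ → ℝ) : Prop :=
  (∀ᵐ t ∂(MeasureTheory.volume.restrict (Set.Ioo (-T) T)), v t = a ∨ v t = b) ∧
  BddAbove (wTVvals T η v) ∧ massEq T η m v

/-- The single-interface step function `sgn_{a,b}(· - t₀)`. -/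
def stepAB (a b t₀ : ℝ) : ℝ → ℝ := fun t => if t ≤ t₀ then a else b

/-- Admissibility for the localized functional `J_ε`: `H¹_η` membership, mass
constraint, and distance at most `δ` from `v₀` in `L¹_η`. -/
def Adm (T : ℝ) (η : ℝ → ℝ) (m δ : ℝ) (v₀ v : ℝ → ℝ) : Prop :=
  MemH1 T η v ∧ massEq T η m v ∧ dist1 T η v v₀ ≤ δ

/-- `v` is a global minimizer of the localized functional `J_ε`. -/
def IsJMin (T : ℝ) (W η : ℝ → ℝ) (m δ ε : ℝ) (v₀ v : ℝ → ℝ) : Prop :=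
  Adm T η m δ v₀ v ∧
  ∀ w, Adm T η m δ v₀ w → ennEnergy T W η ε v ≤ ennEnergy T W η ε w

end

theorem GB_right_local (v w η : ℝ → ℝ) (K x y : ℝ) (hK : 0 ≤ K) (hxy : x < y)
    (hv : ∀ z ∈ Ico x y, HasDerivAt v (w z) z)
    (hη : ContinuousAt η x) (hη0 : ∀ z ∈ Ico x y, η z ≠ 0)
    (hp : ∀ z ∈ Ioo x y, ∃ p', HasDerivAt (fun s => w s * η s) p' z ∧ |p'| ≤ K) :
    ∀ z ∈ Ioo x y, |w z * η z - w x * η x| ≤ K * |z - x| := by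
  have hlip : LipschitzOnWith K.toNNReal (fun s => w s * η s) (Ioo x y) := by
    choose! p' hp' using hp
    refine Convex.lipschitzOnWith_of_nnnorm_hasDerivWithin_le (f' := p') (convex_Ioo x y)
      (fun z hz => (hp' z hz).1.hasDerivWithinAt) (fun z hz => ?_)
    have h5 := (hp' z hz).2
    have h6 : ((‖p' z‖₊ : NNReal) : ℝ) ≤ ((K.toNNReal : NNReal) : ℝ) := by
      rw [Real.coe_toNNReal K hK]; simpa using h5
    exact NNReal.coe_le_coe.1 h6
  obtain ⟨g, hg, hgeq⟩ := hlip.extend_real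
  have hev : ∀ᶠ z in 𝓝[>] x, z ∈ Ioo x y := Ioo_mem_nhdsGT hxy
  have hw : Tendsto (fun z => g z / η z) (𝓝[>] x) (𝓝 (g x / η x)) := by
    have hx := hη0 x ⟨le_rfl, hxy⟩
    exact (hg.continuous.continuousAt.div hη hx).tendsto.mono_left nhdsWithin_le_nhds
  have hd : Tendsto (fun z => deriv v z) (𝓝[>] x) (𝓝 (g x / η x)) := by
    refine hw.congr' ?_
    filter_upwards [hev] with z hz
    have hz' : z ∈ Ico x y := ⟨hz.1.le, hz.2⟩
    rw [(hv z hz').deriv, ← hgeq hz]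
    exact mul_div_cancel_right₀ _ (hη0 z hz')
  have h1 : HasDerivWithinAt v (g x / η x) (Ici x) x :=
    hasDerivWithinAt_Ici_of_tendsto_deriv (s := Ioo x y)
      (fun z hz => (hv z ⟨hz.1.le, hz.2⟩).differentiableAt.differentiableWithinAt)
      (hv x ⟨le_rfl, hxy⟩).continuousAt.continuousWithinAt hev hd
  have h2 : w x = g x / η x :=
    (uniqueDiffWithinAt_Ici x).eq_deriv _ (hv x ⟨le_rfl, hxy⟩).hasDerivWithinAt h1
  have h3 : w x * η x = g x := by
    rw [h2]; exact div_mul_cancel₀ _ (hη0 x ⟨le_rfl, hxy⟩)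
  intro z hz
  have h4 : w z * η z = g z := hgeq hz
  rw [h3, h4]
  have := hg.dist_le_mul z x
  rwa [Real.coe_toNNReal K hK, Real.dist_eq, Real.dist_eq] at this

theorem GB_left_local (v w η : ℝ → ℝ) (K x y : ℝ) (hK : 0 ≤ K) (hxy : y < x)
    (hv : ∀ z ∈ Ioc y x, HasDerivAt v (w z) z)
    (hη : ContinuousAt η x) (hη0 : ∀ z ∈ Ioc y x, η z ≠ 0)
    (hp : ∀ z ∈ Ioo y x, ∃ p', HasDerivAt (fun s => w s * η s) p' z ∧ |p'| ≤ K) :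
    ∀ z ∈ Ioo y x, |w z * η z - w x * η x| ≤ K * |z - x| := by
  have hh := GB_right_local (fun s => v (-s)) (fun s => - w (-s)) (fun s => η (-s)) K (-x) (-y) hK
    (by linarith) ?_ ?_ ?_ ?_
  · intro z hz
    have := hh (-z) ⟨by linarith [hz.2], by linarith [hz.1]⟩
    simp only [neg_neg] at this
    rw [abs_sub_comm z x, show x - z = -z - -x by ring]
    refine le_trans (le_of_eq ?_) this
    rw [← abs_neg]; congr 1; ring
  · intro z hz
    have h := hv (-z) ⟨by linarith [hz.2], by linarith [hz.1]⟩
    have h2 := HasDerivAt.comp z h (hasDerivAt_neg z)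
    rw [mul_neg_one] at h2
    exact h2
  · have : ContinuousAt η (- -x) := by simpa using hη
    exact this.comp continuous_neg.continuousAt
  · intro z hz
    exact hη0 (-z) ⟨by linarith [hz.2], by linarith [hz.1]⟩
  · intro z hz
    obtain ⟨p', h1, h2⟩ := hp (-z) ⟨by linarith [hz.2], by linarith [hz.1]⟩
    refine ⟨p', ?_, h2⟩
    have h3 := (HasDerivAt.comp z h1 (hasDerivAt_neg z)).neg
    rw [mul_neg_one, neg_neg] at h3
    refine h3.congr_of_eventuallyEq (Filter.Eventually.of_forall fun s => ?_)
    simp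

theorem GB_forward (v w η : ℝ → ℝ) (Z : Set ℝ) (hZ : Z.Finite) (K s t : ℝ) (hK : 0 ≤ K) (hst : s < t)
    (hv : ∀ z ∈ Icc s t, HasDerivAt v (w z) z)
    (hη : ∀ z ∈ Icc s t, ContinuousAt η z) (hη0 : ∀ z ∈ Icc s t, η z ≠ 0)
    (hp : ∀ z ∈ Ioo s t, v z ∉ Z → ∃ p', HasDerivAt (fun s => w s * η s) p' z ∧ |p'| ≤ K) :
    |w t * η t| ≤ |w s * η s| + K * (t - s) := by
  set p : ℝ → ℝ := fun s => w s * η s with hpdef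
  -- key: interval free of zeros
  have key : ∀ α ∈ Ico s t, (∀ x ∈ Ioo α t, w x ≠ 0) → |p t| ≤ |p α| + K * (t - α) := by
    intro α hα hne
    have hinj : InjOn v (Icc α t) := by
      intro x hx y hy hxy
      by_contra hne'
      wlog hlt : x < y generalizing x y
      · exact this hy hx hxy.symm (Ne.symm hne') (lt_of_le_of_ne (not_lt.1 hlt) (Ne.symm hne'))
      obtain ⟨z, hz, hz0⟩ := exists_hasDerivAt_eq_zero (f := v) (f' := w) hlt
        (fun z hz => (hv z ⟨hα.1.trans (hx.1.trans hz.1), hz.2.trans hy.2⟩).continuousAt.continuousWithinAt) hxy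
        (fun z hz => hv z ⟨hα.1.trans (hx.1.trans hz.1.le), hz.2.le.trans hy.2⟩)
      exact hne z ⟨lt_of_le_of_lt hx.1 hz.1, lt_of_lt_of_le hz.2 hy.2⟩ hz0
    have hE : (Icc α t ∩ v ⁻¹' Z).Finite := by
      refine Set.Finite.of_finite_image (f := v) (hZ.subset ?_) (hinj.mono inter_subset_left)
      rintro _ ⟨u, hu, rfl⟩
      exact hu.2
    have hE2 : ((Icc α t ∩ v ⁻¹' Z) ∪ {α, t}).Finite := hE.union (Set.toFinite _)
    have hloc : ∀ x ∈ Icc α t, ∃ r > 0, ∀ z ∈ Icc α t, |z - x| < r →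
        |p z - p x| ≤ K * |z - x| := by
      intro x hx
      have hc : IsClosed (((Icc α t ∩ v ⁻¹' Z) ∪ {α, t}) \ {x}) := (hE2.subset sdiff_subset).isClosed
      have hn : (((Icc α t ∩ v ⁻¹' Z) ∪ {α, t}) \ {x})ᶜ ∈ 𝓝 x :=
        hc.isOpen_compl.mem_nhds (fun h => h.2 rfl)
      obtain ⟨r, hr, hball⟩ := Metric.mem_nhds_iff.1 hn
      have hnz : ∀ z ∈ Icc α t, |z - x| < r → z ≠ x → v z ∉ Z := by
        intro z hz hzr hzx hzZ
        exact hball (show z ∈ Metric.ball x r from hzr) ⟨Or.inl ⟨hz, hzZ⟩, hzx⟩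
      have hend : ∀ z ∈ Icc α t, |z - x| < r → z ≠ x → α < z ∧ z < t := by
        intro z hz hzr hzx
        refine ⟨lt_of_le_of_ne hz.1 fun h => ?_, lt_of_le_of_ne hz.2 fun h => ?_⟩
        · exact hball (show z ∈ Metric.ball x r from hzr) ⟨Or.inr (by simp [h]), hzx⟩
        · exact hball (show z ∈ Metric.ball x r from hzr) ⟨Or.inr (by simp [h]), hzx⟩
      refine ⟨r, hr, fun z hz hzr => ?_⟩
      rcases lt_trichotomy z x with h | h | h
      · have hza := (hend z hz hzr h.ne).1
        rw [abs_lt] at hzr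
        exact GB_left_local v w η K x (max α (x - r)) hK
          (max_lt (lt_of_le_of_lt hz.1 h) (by linarith))
          (fun u hu => hv u ⟨hα.1.trans ((le_max_left _ _).trans hu.1.le), hu.2.trans hx.2⟩)
          (hη x ⟨hα.1.trans hx.1, hx.2⟩)
          (fun u hu => hη0 u ⟨hα.1.trans ((le_max_left _ _).trans hu.1.le), hu.2.trans hx.2⟩)
          (fun u hu => hp u ⟨lt_of_le_of_lt (hα.1.trans (le_max_left _ _)) hu.1,
              lt_of_lt_of_le hu.2 hx.2⟩
            (hnz u ⟨(le_max_left _ _).trans hu.1.le, hu.2.le.trans hx.2⟩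
              (by rw [abs_lt]; have := lt_of_le_of_lt (le_max_right α (x - r)) hu.1; have := hu.2
                  constructor <;> linarith) hu.2.ne))
          z ⟨max_lt hza (by linarith), h⟩
      · subst h; simp
      · have hza := (hend z hz hzr h.ne').2
        rw [abs_lt] at hzr
        exact GB_right_local v w η K x (min t (x + r)) hK
          (lt_min (lt_of_lt_of_le h hz.2) (by linarith))
          (fun u hu => hv u ⟨hα.1.trans (hx.1.trans hu.1), hu.2.le.trans (min_le_left _ _)⟩)
          (hη x ⟨hα.1.trans hx.1, hx.2⟩)
          (fun u hu => hη0 u ⟨hα.1.trans (hx.1.trans hu.1), hu.2.le.trans (min_le_left _ _)⟩)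
          (fun u hu => hp u ⟨lt_of_le_of_lt (hα.1.trans hx.1) hu.1,
              lt_of_lt_of_le hu.2 (min_le_left _ _)⟩
            (hnz u ⟨hx.1.trans hu.1.le, hu.2.le.trans (min_le_left _ _)⟩
              (by rw [abs_lt]; have := lt_of_lt_of_le hu.2 (min_le_right t (x + r)); have := hu.1
                  constructor <;> linarith) hu.1.ne'))
          z ⟨h, lt_min hza (by linarith)⟩
    have hcont : ContinuousOn p (Icc α t) := by
      intro x hx
      obtain ⟨r, hr, hl⟩ := hloc x hx
      have h1 : Tendsto (fun z => K * |z - x|) (𝓝[Icc α t] x) (𝓝 0) := by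
        have : Continuous (fun z => K * |z - x|) := by fun_prop
        have h2 := this.tendsto x
        simp only [sub_self, abs_zero, mul_zero] at h2
        exact h2.mono_left nhdsWithin_le_nhds
      refine tendsto_iff_dist_tendsto_zero.2 (squeeze_zero' (Eventually.of_forall fun _ => dist_nonneg) ?_ h1)
      filter_upwards [self_mem_nhdsWithin, mem_nhdsWithin_of_mem_nhds (Metric.ball_mem_nhds x hr)]
        with z hz hzr
      exact hl z hz hzr
    refine le_of_forall_pos_le_add fun e he => ?_
    have hta : 0 < t - α := by linarith [hα.2]
    have hmain := image_norm_le_of_liminf_right_slope_norm_lt_deriv_boundary (a := α) (b := t)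
      (f := p) (f' := fun _ => K) (B := fun x => |p α| + (K + e / (t - α)) * (x - α))
      (B' := fun _ => K + e / (t - α)) hcont ?_ (by simp) (by fun_prop) ?_ ?_
      (x := t) ⟨hα.2.le, le_rfl⟩
    · have h3 : (K + e / (t - α)) * (t - α) = K * (t - α) + e := by
        field_simp
      simp only [Real.norm_eq_abs, h3] at hmain
      linarith
    · intro x hx r hr
      obtain ⟨r', hr', hl⟩ := hloc x ⟨hx.1, hx.2.le⟩
      refine Eventually.frequently ?_
      have hy : x < min t (x + r') := lt_min hx.2 (by linarith)
      filter_upwards [Ioo_mem_nhdsGT hy] with z hz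
      have hz1 := lt_of_lt_of_le hz.2 (min_le_left _ _)
      have hz2 := lt_of_lt_of_le hz.2 (min_le_right _ _)
      have hz0 : 0 < z - x := by linarith [hz.1]
      have h4 := hl z ⟨hx.1.trans hz.1.le, hz1.le⟩ (by rw [abs_of_pos hz0]; linarith)
      rw [abs_of_pos hz0] at h4
      rw [slope_def_field, div_lt_iff₀ hz0]
      simp only [Function.comp, Real.norm_eq_abs]
      have h5 := abs_sub_abs_le_abs_sub (p z) (p x)
      nlinarith
    · intro x hx
      have : HasDerivAt (fun x => |p α| + (K + e / (t - α)) * (x - α)) (K + e / (t - α)) x := by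
        simpa using (((hasDerivAt_id x).sub_const α).const_mul (K + e / (t - α))).const_add (|p α|)
      exact this.hasDerivWithinAt
    · intro x hx _
      have : 0 < e / (t - α) := by positivity
      linarith
  by_cases hwt : w t = 0
  · have : 0 ≤ K * (t - s) := mul_nonneg hK (by linarith)
    simp only [hwt, zero_mul, abs_zero]
    positivity
  set S : Set ℝ := {x | x ∈ Icc s t ∧ w x = 0} with hS
  by_cases hSe : S.Nonempty
  swap
  · refine key s ⟨le_rfl, hst⟩ fun x hx h0 => hSe ⟨x, ⟨hx.1.le, hx.2.le⟩, h0⟩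
  have hbdd : BddAbove S := ⟨t, fun x hx => hx.1.2⟩
  set α := sSup S with hαdef
  have hαs : s ≤ α := by
    obtain ⟨x, hx⟩ := hSe
    exact hx.1.1.trans (le_csSup hbdd hx)
  have hαt : α ≤ t := csSup_le hSe fun x hx => hx.1.2
  have hw0 : w α = 0 := by
    by_contra hne
    have hlt : ∀ x ∈ S, x < α := fun x hx =>
      lt_of_le_of_ne (le_csSup hbdd hx) fun h => hne (h ▸ hx.2)
    obtain ⟨x0, hx0⟩ := hSe
    have hsα : s < α := lt_of_le_of_lt hx0.1.1 (hlt x0 hx0)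
    have hmem : α ∈ Icc s t := ⟨hαs, hαt⟩
    have hev : ∀ᶠ z in 𝓝[≠] α, v z ∉ Z := by
      have h1 : ∀ᶠ z in 𝓝[≠] α, ∀ c ∈ Z, v z ≠ c :=
        (Filter.eventually_all_finite hZ).2 fun c _ => (hv α hmem).eventually_ne hne
      filter_upwards [h1] with z hz hzZ
      exact hz _ hzZ rfl
    rw [eventually_nhdsWithin_iff, Metric.eventually_nhds_iff] at hev
    obtain ⟨r, hr, hev⟩ := hev
    have hloc := GB_left_local v w η K α (max s (α - r)) hK (max_lt hsα (by linarith))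
      (fun u hu => hv u ⟨(le_max_left _ _).trans hu.1.le, hu.2.trans hαt⟩)
      (hη α hmem)
      (fun u hu => hη0 u ⟨(le_max_left _ _).trans hu.1.le, hu.2.trans hαt⟩)
      (fun u hu => hp u ⟨lt_of_le_of_lt (le_max_left _ _) hu.1, lt_of_lt_of_le hu.2 hαt⟩
        (hev (by rw [Real.dist_eq, abs_lt]
                 have := lt_of_le_of_lt (le_max_right s (α - r)) hu.1; have := hu.2
                 constructor <;> linarith) hu.2.ne))
    have hpα : 0 < |w α * η α| := abs_pos.2 (mul_ne_zero hne (hη0 α hmem))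
    set g := |w α * η α| / (K + 1) with hg
    have hgpos : 0 < g := by positivity
    obtain ⟨x, hxS, hx⟩ := exists_lt_of_lt_csSup ⟨x0, hx0⟩
      (show max (max s (α - r)) (α - g) < sSup S from
        max_lt (max_lt hsα (by linarith)) (by linarith))
    have h6 := hloc x ⟨lt_of_le_of_lt (le_max_left _ _) hx, hlt x hxS⟩
    have h7 := lt_of_le_of_lt (le_max_right (max s (α - r)) (α - g)) hx
    rw [hxS.2, zero_mul, zero_sub, abs_neg, abs_sub_comm, abs_of_pos (show 0 < α - x by linarith [hlt x hxS])] at h6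
    have h8 : g * (K + 1) = |w α * η α| := by rw [hg]; field_simp
    nlinarith
  have hαlt : α < t := lt_of_le_of_ne hαt fun h => hwt (h ▸ hw0)
  have h9 := key α ⟨hαs, hαlt⟩ fun x hx h0 =>
    absurd (le_csSup hbdd (show x ∈ S from ⟨⟨hαs.trans hx.1.le, hx.2.le⟩, h0⟩)) (not_le.2 hx.1)
  have h10 : |p α| = 0 := by simp [hpdef, hw0]
  have h11 : K * (t - α) ≤ K * (t - s) := by gcongr
  have := abs_nonneg (w s * η s)
  have h12 : |p t| = |w t * η t| := rfl
  linarith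

theorem GB_bdry (v w η : ℝ → ℝ) (Z : Set ℝ) (hZ : Z.Finite) (A t M D : ℝ) (hM : 0 ≤ M)
    (hD : 0 ≤ D) (hAt : A < t)
    (hv : ∀ z ∈ Ioc A t, HasDerivAt v (w z) z)
    (hη : ∀ z ∈ Ioc A t, ContinuousAt η z) (hη0 : ∀ z ∈ Ioc A t, 0 < η z)
    (hηD : ∀ z ∈ Ioc A t, η z ≤ D * η t)
    (hp : ∀ z ∈ Ioo A t, v z ∉ Z →
      ∃ p', HasDerivAt (fun s => w s * η s) p' z ∧ |p'| ≤ M * η z)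
    (hlim : Tendsto w (𝓝[>] A) (𝓝 0)) :
    |w t| ≤ M * D * (t - A) := by
  have hηt : 0 < η t := hη0 t ⟨hAt, le_rfl⟩
  have h1 : ∀ s ∈ Ioo A t, |w t| ≤ |w s| * D + M * D * (t - A) := by
    intro s hs
    have h := GB_forward v w η Z hZ (M * (D * η t)) s t (by positivity) hs.2
      (fun z hz => hv z ⟨lt_of_lt_of_le hs.1 hz.1, hz.2⟩)
      (fun z hz => hη z ⟨lt_of_lt_of_le hs.1 hz.1, hz.2⟩)
      (fun z hz => (hη0 z ⟨lt_of_lt_of_le hs.1 hz.1, hz.2⟩).ne')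
      (fun z hz hzZ => by
        obtain ⟨p', h1, h2⟩ := hp z ⟨hs.1.trans hz.1, hz.2⟩ hzZ
        exact ⟨p', h1, h2.trans (mul_le_mul_of_nonneg_left
          (hηD z ⟨hs.1.trans hz.1, hz.2.le⟩) hM)⟩)
    have hs0 := hη0 s ⟨hs.1, hs.2.le⟩
    have hsD := hηD s ⟨hs.1, hs.2.le⟩
    rw [abs_mul, abs_mul, abs_of_pos hηt, abs_of_pos hs0] at h
    have h2 : |w s| * η s ≤ |w s| * (D * η t) := by gcongr
    have h3 : M * (D * η t) * (t - s) ≤ M * (D * η t) * (t - A) := by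
      have := hs.1
      gcongr
    have h4 : |w t| * η t ≤ (|w s| * D + M * D * (t - A)) * η t := by nlinarith
    exact le_of_mul_le_mul_right h4 hηt
  have h2 : Tendsto (fun s => |w s| * D + M * D * (t - A)) (𝓝[>] A)
      (𝓝 (|(0:ℝ)| * D + M * D * (t - A))) := ((hlim.abs).mul_const D).add_const _
  simp only [abs_zero, zero_mul, zero_add] at h2
  refine ge_of_tendsto h2 ?_
  filter_upwards [Ioo_mem_nhdsGT hAt] with s hs using h1 s hs

theorem GB_bdry_right (v w η : ℝ → ℝ) (Z : Set ℝ) (hZ : Z.Finite) (A t M D : ℝ) (hM : 0 ≤ M)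
    (hD : 0 ≤ D) (hAt : t < A)
    (hv : ∀ z ∈ Ico t A, HasDerivAt v (w z) z)
    (hη : ∀ z ∈ Ico t A, ContinuousAt η z) (hη0 : ∀ z ∈ Ico t A, 0 < η z)
    (hηD : ∀ z ∈ Ico t A, η z ≤ D * η t)
    (hp : ∀ z ∈ Ioo t A, v z ∉ Z →
      ∃ p', HasDerivAt (fun s => w s * η s) p' z ∧ |p'| ≤ M * η z)
    (hlim : Tendsto w (𝓝[<] A) (𝓝 0)) :
    |w t| ≤ M * D * (A - t) := by
  have hh := GB_bdry (fun s => v (-s)) (fun s => - w (-s)) (fun s => η (-s)) Z hZ (-A) (-t) M D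
    hM hD (by linarith) ?_ ?_ ?_ ?_ ?_ ?_
  · simp only [neg_neg, abs_neg] at hh
    rwa [show -t - -A = A - t by ring] at hh
  · intro z hz
    have h := hv (-z) ⟨by linarith [hz.2], by linarith [hz.1]⟩
    have h2 := HasDerivAt.comp z h (hasDerivAt_neg z)
    rw [mul_neg_one] at h2
    exact h2
  · intro z hz
    exact (hη (-z) ⟨by linarith [hz.2], by linarith [hz.1]⟩).comp continuous_neg.continuousAt
  · intro z hz
    exact hη0 (-z) ⟨by linarith [hz.2], by linarith [hz.1]⟩
  · intro z hz
    simp only [neg_neg]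
    exact hηD (-z) ⟨by linarith [hz.2], by linarith [hz.1]⟩
  · intro z hz hzZ
    obtain ⟨p', h1, h2⟩ := hp (-z) ⟨by linarith [hz.2], by linarith [hz.1]⟩ hzZ
    refine ⟨p', ?_, h2⟩
    have h3 := (HasDerivAt.comp z h1 (hasDerivAt_neg z)).neg
    rw [mul_neg_one, neg_neg] at h3
    refine h3.congr_of_eventuallyEq (Filter.Eventually.of_forall fun s => ?_)
    simp
  · have h1 : Tendsto (fun s : ℝ => -s) (𝓝[>] (-A)) (𝓝[<] A) := by
      have := tendsto_neg_nhdsGT_neg (a := A)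
      simpa using this
    simpa using (hlim.comp h1).neg

theorem GB_interior (v w η : ℝ → ℝ) (Z : Set ℝ) (hZ : Z.Finite) (r t M D R : ℝ) (hM : 0 ≤ M)
    (hD : 0 ≤ D) (hrt : r < t)
    (hv : ∀ z ∈ Icc r t, HasDerivAt v (w z) z)
    (hη : ∀ z ∈ Icc r t, ContinuousAt η z) (hη0 : ∀ z ∈ Icc r t, 0 < η z)
    (hηD : ∀ z ∈ Icc r t, η z ≤ D * η t)
    (hp : ∀ z ∈ Ioo r t, v z ∉ Z →
      ∃ p', HasDerivAt (fun s => w s * η s) p' z ∧ |p'| ≤ M * η z)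
    (hR : |v t - v r| ≤ R) :
    |w t| ≤ R / (t - r) * D + M * D * (t - r) := by
  have hηt : 0 < η t := hη0 t ⟨hrt.le, le_rfl⟩
  obtain ⟨s, hs, hsl⟩ := exists_hasDerivAt_eq_slope v w hrt
    (fun z hz => (hv z hz).continuousAt.continuousWithinAt) (fun z hz => hv z ⟨hz.1.le, hz.2.le⟩)
  have hpos : 0 < t - r := by linarith
  have hws : |w s| ≤ R / (t - r) := by
    rw [hsl, abs_div, abs_of_pos hpos]
    gcongr
  have h := GB_forward v w η Z hZ (M * (D * η t)) s t (by positivity) hs.2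
      (fun z hz => hv z ⟨hs.1.le.trans hz.1, hz.2⟩)
      (fun z hz => hη z ⟨hs.1.le.trans hz.1, hz.2⟩)
      (fun z hz => (hη0 z ⟨hs.1.le.trans hz.1, hz.2⟩).ne')
      (fun z hz hzZ => by
        obtain ⟨p', h1, h2⟩ := hp z ⟨hs.1.trans hz.1, hz.2⟩ hzZ
        exact ⟨p', h1, h2.trans (mul_le_mul_of_nonneg_left
          (hηD z ⟨(hs.1.trans hz.1).le, hz.2.le⟩) hM)⟩)
  have hs0 := hη0 s ⟨hs.1.le, hs.2.le⟩
  have hsD := hηD s ⟨hs.1.le, hs.2.le⟩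
  rw [abs_mul, abs_mul, abs_of_pos hηt, abs_of_pos hs0] at h
  have h2 : |w s| * η s ≤ R / (t - r) * (D * η t) :=
    mul_le_mul hws hsD hs0.le ((abs_nonneg _).trans hws)
  have h3 : M * (D * η t) * (t - s) ≤ M * (D * η t) * (t - r) := by
    have := hs.1
    gcongr
  have h4 : |w t| * η t ≤ (R / (t - r) * D + M * D * (t - r)) * η t := by nlinarith
  exact le_of_mul_le_mul_right h4 hηt

theorem GB_eta_ratio (η : ℝ → ℝ) (s t k : ℝ)
    (hd : ∀ z ∈ Icc s t, DifferentiableAt ℝ η z) (hpos : ∀ z ∈ Icc s t, 0 < η z)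
    (hb : ∀ z ∈ Icc s t, |deriv η z| ≤ k * η z) (hst : s ≤ t) :
    η s ≤ Real.exp (k * (t - s)) * η t := by
  have h := Convex.norm_image_sub_le_of_norm_hasDerivWithin_le (f := fun z => Real.log (η z))
    (f' := fun z => deriv η z / η z) (s := Icc s t) (C := k) (x := t) (y := s)
    (fun z hz => ((hd z hz).hasDerivAt.log (hpos z hz).ne').hasDerivWithinAt)
    (fun z hz => by
      rw [Real.norm_eq_abs, abs_div, abs_of_pos (hpos z hz), div_le_iff₀ (hpos z hz)]
      exact hb z hz) (convex_Icc s t) ⟨hst, le_rfl⟩ ⟨le_rfl, hst⟩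
  simp only [Real.norm_eq_abs] at h
  rw [abs_sub_comm s t, abs_of_nonneg (by linarith : 0 ≤ t - s)] at h
  have h2 := (le_abs_self _).trans h
  have hs := hpos s ⟨le_rfl, hst⟩
  have ht := hpos t ⟨hst, le_rfl⟩
  calc η s = Real.exp (Real.log (η s)) := (Real.exp_log hs).symm
    _ ≤ Real.exp (k * (t - s) + Real.log (η t)) := Real.exp_le_exp.2 (by linarith)
    _ = _ := by rw [Real.exp_add, Real.exp_log ht]

theorem GB_bdd_half (f f' : ℝ → ℝ) (q C r : ℝ) (hq : 0 < q) (hr : 0 < r)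
    (hf : ∀ x ∈ Ioo 0 r, HasDerivAt f (f' x) x)
    (hb : ∀ x ∈ Ioo 0 r, |f' x| ≤ C * x ^ (q - 1)) :
    ∃ B, ∀ x ∈ Ioo 0 (r / 2), |f x| ≤ B := by
  have hpow : ∀ x ∈ Ioo 0 r, HasDerivAt (fun x : ℝ => C / q * x ^ q) (C * x ^ (q - 1)) x := by
    intro x hx
    have := (Real.hasDerivAt_rpow_const (x := x) (p := q) (Or.inl hx.1.ne')).const_mul (C / q)
    refine this.congr_deriv ?_
    field_simp
  have hC : 0 ≤ C := by
    have h := (abs_nonneg _).trans (hb (r / 2) ⟨by linarith, by linarith⟩)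
    have h2 : 0 < (r / 2) ^ (q - 1) := Real.rpow_pos_of_pos (by linarith) _
    exact nonneg_of_mul_nonneg_left h h2
  have hm : MonotoneOn (fun x => f x + C / q * x ^ q) (Ioo 0 r) := by
    refine monotoneOn_of_hasDerivWithinAt_nonneg (f' := fun x => f' x + C * x ^ (q - 1))
      (convex_Ioo 0 r)
      (fun x hx => ((hf x hx).add (hpow x hx)).continuousAt.continuousWithinAt) ?_ ?_
    · intro x hx
      rw [interior_Ioo] at hx
      exact ((hf x hx).add (hpow x hx)).hasDerivWithinAt
    · intro x hx
      rw [interior_Ioo] at hx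
      have := (abs_le.1 (hb x hx)).1
      linarith
  have ha : AntitoneOn (fun x => f x - C / q * x ^ q) (Ioo 0 r) := by
    refine antitoneOn_of_hasDerivWithinAt_nonpos (f' := fun x => f' x - C * x ^ (q - 1))
      (convex_Ioo 0 r)
      (fun x hx => ((hf x hx).sub (hpow x hx)).continuousAt.continuousWithinAt) ?_ ?_
    · intro x hx
      rw [interior_Ioo] at hx
      exact ((hf x hx).sub (hpow x hx)).hasDerivWithinAt
    · intro x hx
      rw [interior_Ioo] at hx
      have := (abs_le.1 (hb x hx)).2
      linarith
  have hmid : r / 2 ∈ Ioo 0 r := ⟨by linarith, by linarith⟩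
  refine ⟨|f (r / 2)| + C / q * (r / 2) ^ q, fun x hx => ?_⟩
  have hx' : x ∈ Ioo 0 r := ⟨hx.1, by linarith [hx.2]⟩
  have h1 := hm hx' hmid hx.2.le
  have h2 := ha hx' hmid hx.2.le
  simp only at h1 h2
  have h3 : 0 ≤ C / q * x ^ q := mul_nonneg (by positivity) (Real.rpow_nonneg hx.1.le _)
  rw [abs_le]
  constructor
  · linarith [neg_abs_le (f (r / 2))]
  · linarith [le_abs_self (f (r / 2))]

theorem GB_bdd_sing (g : ℝ → ℝ) (x₀ q l : ℝ) (hq : 0 < q)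
    (hd : ∀ᶠ s in 𝓝[≠] x₀, DifferentiableAt ℝ g s)
    (hlim : Tendsto (fun s => deriv g s / |s - x₀| ^ (q - 1)) (𝓝[≠] x₀) (𝓝 l)) :
    ∃ B, ∀ᶠ s in 𝓝 x₀, |g s| ≤ B := by
  have h1 : ∀ᶠ s in 𝓝[≠] x₀, |deriv g s / |s - x₀| ^ (q - 1)| < |l| + 1 :=
    (hlim.abs).eventually (gt_mem_nhds (by linarith))
  have h2 := hd.and h1
  rw [eventually_nhdsWithin_iff, Metric.eventually_nhds_iff] at h2
  obtain ⟨r, hr, h2⟩ := h2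
  have h3 : ∀ s, s ≠ x₀ → |s - x₀| < r → |deriv g s| ≤ (|l| + 1) * |s - x₀| ^ (q - 1) := by
    intro s hs hsr
    have h := (h2 (y := s) hsr hs).2
    have hp : 0 < |s - x₀| ^ (q - 1) := Real.rpow_pos_of_pos (abs_pos.2 (sub_ne_zero.2 hs)) _
    rw [abs_div, abs_of_pos hp, div_lt_iff₀ hp] at h
    exact h.le
  obtain ⟨B1, hB1⟩ := GB_bdd_half (fun x => g (x₀ + x)) (fun x => deriv g (x₀ + x)) q (|l| + 1) r hq hr
    (fun x hx => by
      have h := (h2 (y := x₀ + x) (by simp [Real.dist_eq, abs_of_pos hx.1, hx.2])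
        (by simp [hx.1.ne'])).1.hasDerivAt
      exact h.comp_const_add x₀ x)
    (fun x hx => by
      have := h3 (x₀ + x) (by simp [hx.1.ne']) (by simp [abs_of_pos hx.1, hx.2])
      simpa [abs_of_pos hx.1] using this)
  obtain ⟨B2, hB2⟩ := GB_bdd_half (fun x => g (x₀ - x)) (fun x => - deriv g (x₀ - x)) q (|l| + 1) r hq hr
    (fun x hx => by
      have h := (h2 (y := x₀ - x) (by simp [Real.dist_eq, abs_of_pos hx.1, hx.2])
        (by simp [hx.1.ne'])).1.hasDerivAt
      exact h.comp_const_sub x₀ x)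
    (fun x hx => by
      have := h3 (x₀ - x) (by simp [hx.1.ne']) (by simp [abs_of_pos hx.1, hx.2])
      simpa [abs_of_pos hx.1] using this)
  refine ⟨max (max B1 B2) |g x₀|, ?_⟩
  filter_upwards [Metric.ball_mem_nhds x₀ (half_pos hr)] with s hs
  have hs' : |s - x₀| < r / 2 := hs
  rw [abs_lt] at hs'
  rcases lt_trichotomy s x₀ with h | h | h
  · have := hB2 (x₀ - s) ⟨by linarith, by linarith⟩
    rw [sub_sub_cancel] at this
    exact this.trans ((le_max_right _ _).trans (le_max_left _ _))
  · rw [h]; exact le_max_right _ _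
  · have := hB1 (s - x₀) ⟨by linarith, by linarith⟩
    rw [add_sub_cancel] at this
    exact this.trans ((le_max_left _ _).trans (le_max_left _ _))

theorem GB_W_bdd (W : ℝ → ℝ) (a b c q l : ℝ) (hW : DoubleWell W a b c q l) (R : ℝ) :
    ∃ B, ∀ s ∈ Icc (-R) R, |deriv W s| ≤ B := by
  have hopen : IsOpen (({a, b} : Set ℝ)ᶜ) := (Set.toFinite _).isClosed.isOpen_compl
  have hdW : ContDiffOn ℝ 1 (deriv W) (({a, b} : Set ℝ)ᶜ) :=
    hW.smooth.deriv_of_isOpen hopen (by norm_num)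
  have hdiff : ∀ s ∈ (({a, b} : Set ℝ)ᶜ), DifferentiableAt ℝ (deriv W) s := fun s hs =>
    (hdW.differentiableOn (by norm_num)).differentiableAt (hopen.mem_nhds hs)
  have hne : ∀ x : ℝ, ∀ᶠ s in 𝓝[≠] x, s ∈ (({a, b} : Set ℝ)ᶜ) := by
    intro x
    have hc : IsClosed (({a, b} : Set ℝ) \ {x}) := (Set.toFinite _).isClosed
    have hn : (({a, b} : Set ℝ) \ {x})ᶜ ∈ 𝓝 x := hc.isOpen_compl.mem_nhds (fun h => h.2 rfl)
    filter_upwards [self_mem_nhdsWithin, mem_nhdsWithin_of_mem_nhds hn] with s h1 h2 h3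
    exact h2 ⟨h3, h1⟩
  have hloc : ∀ x : ℝ, ∃ B, ∀ᶠ s in 𝓝 x, |deriv W s| ≤ B := by
    intro x
    by_cases hxa : x = a
    · subst hxa
      exact GB_bdd_sing _ _ q l hW.q_mem.1 ((hne x).mono hdiff) hW.lim_a
    by_cases hxb : x = b
    · subst hxb
      exact GB_bdd_sing _ _ q l hW.q_mem.1 ((hne x).mono hdiff) hW.lim_b
    refine ⟨|deriv W x| + 1, ?_⟩
    have hx : x ∈ (({a, b} : Set ℝ)ᶜ) := by simp [hxa, hxb]
    have := (hdiff x hx).continuousAt.abs.eventually (gt_mem_nhds (lt_add_one (|deriv W x|)))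
    exact this.mono fun s hs => hs.le
  refine (isCompact_Icc (a := -R) (b := R)).induction_on
    (p := fun K => ∃ B, ∀ s ∈ K, |deriv W s| ≤ B) ⟨0, by simp⟩ ?_ ?_ ?_
  · rintro s t hst ⟨B, hB⟩
    exact ⟨B, fun x hx => hB x (hst hx)⟩
  · rintro s t ⟨B, hB⟩ ⟨B', hB'⟩
    refine ⟨max B B', fun x hx => ?_⟩
    rcases hx with hx | hx
    · exact (hB x hx).trans (le_max_left _ _)
    · exact (hB' x hx).trans (le_max_right _ _)
  · intro x _
    obtain ⟨B, hB⟩ := hloc x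
    exact ⟨_, mem_nhdsWithin_of_mem_nhds hB, B, fun s hs => hs⟩

/-- **Gradient bound for minimizers** (Lemma 4.15). For `δ` sufficiently small, let
`v_ε` be global minimizers of `J_ε` satisfying the Euler–Lagrange equation with
Neumann boundary conditions, the bounds `a_ε ≤ v_ε ≤ b_ε` (where `a_ε < c_ε < b_ε`
are the zeros of `W' + ε λ_ε`), and with `λ_ε` converging as `ε → 0⁺`. Then there
is a constant `C > 0` independent of `ε` with `|v_ε'(t)| ≤ C/ε` on `I` for all
sufficiently small `ε > 0`. -/
theorem gradient_bound_for_minimizers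
    (W : ℝ → ℝ) (a b c q l : ℝ) (hW : DoubleWell W a b c q l)
    (T : ℝ) (hT : 0 < T)
    (η : ℝ → ℝ) (β : ℝ) (n₁ n₂ : ℕ) (d₁ d₂ d₃ d₄ d₅ tstar : ℝ)
    (hη : GoodWeight T η β n₁ n₂ d₁ d₂ d₃ d₄ d₅ tstar)
    (m : ℝ)
    (hm₁ : a * (∫ t in Set.Ioo (-T) T, η t) < m)
    (hm₂ : m < b * ∫ t in Set.Ioo (-T) T, η t)
    (t₀ : ℝ) (ht₀ : t₀ ∈ Set.Ioo (-T) T)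
    (hmass₀ : massEq T η m (stepAB a b t₀)) :
    ∃ δ₀ > 0, ∀ δ : ℝ, 0 < δ → δ ≤ δ₀ →
      ∀ (vf : ℝ → (ℝ → ℝ)) (lam aE cE bE : ℝ → ℝ),
        (∀ ε ∈ Set.Ioi (0 : ℝ), IsJMin T W η m δ ε (stepAB a b t₀) (vf ε)) →
        -- Euler–Lagrange equation
        (∀ᶠ ε in 𝓝[>] (0 : ℝ), ∀ t ∈ Set.Ioo (-T) T,
          2 * ε ^ 2 * deriv (fun s => deriv (vf ε) s * η s) t
            - deriv W (vf ε t) * η t = ε * lam ε * η t) →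
        -- Neumann conditions
        (∀ᶠ ε in 𝓝[>] (0 : ℝ),
          Filter.Tendsto (deriv (vf ε)) (𝓝[>] (-T)) (𝓝 0) ∧
          Filter.Tendsto (deriv (vf ε)) (𝓝[<] T) (𝓝 0)) →
        -- zeros of `W' + ε λ_ε` and tight bounds
        (∀ᶠ ε in 𝓝[>] (0 : ℝ),
          (∀ s : ℝ, deriv W s + ε * lam ε = 0 ↔ s = aE ε ∨ s = cE ε ∨ s = bE ε) ∧
          aE ε < cE ε ∧ cE ε < bE ε ∧
          (∀ t ∈ Set.Ioo (-T) T, aE ε ≤ vf ε t ∧ vf ε t ≤ bE ε)) →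
        -- convergence of the multipliers
        (∃ Λ : ℝ, Filter.Tendsto lam (𝓝[>] (0 : ℝ)) (𝓝 Λ)) →
        ∃ C > 0, ∃ ε₀ > 0, ∀ ε ∈ Set.Ioo (0 : ℝ) ε₀, ∀ t ∈ Set.Ioo (-T) T,
          |deriv (vf ε) t| ≤ C / ε := by
  refine ⟨1, one_pos, ?_⟩
  intro δ hδ _ vf lam aE cE bE hmin hEL hN hZ hlam
  obtain ⟨Λ, hΛ⟩ := hlam
  obtain ⟨L, hL, R, hR⟩ := hW.coercive
  obtain ⟨B₀, hB₀⟩ := GB_W_bdd W a b c q l hW |R|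
  have hsmall : ∀ᶠ ε in 𝓝[>] (0 : ℝ), |ε * lam ε| < min L 1 := by
    have h1 : Tendsto (fun ε : ℝ => ε * lam ε) (𝓝[>] (0 : ℝ)) (𝓝 (0 * Λ)) :=
      (tendsto_id.mono_left nhdsWithin_le_nhds).mul hΛ
    rw [zero_mul] at h1
    have h2 := h1.abs
    rw [abs_zero] at h2
    exact h2.eventually (gt_mem_nhds (lt_min hL one_pos))
  have htst : ∀ᶠ ε in 𝓝[>] (0 : ℝ), ε < tstar :=
    mem_nhdsWithin_of_mem_nhds (gt_mem_nhds hη.tstar_mem.1)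
  have hall := hEL.and (hN.and (hZ.and (hsmall.and htst)))
  rw [eventually_nhdsWithin_iff, Metric.eventually_nhds_iff] at hall
  obtain ⟨ε₀, hε₀, hall⟩ := hall
  set B : ℝ := |B₀| + 1 with hB
  have hBpos : 0 < B := by positivity
  have hd₁ := hη.d₁_pos
  have hd₂ := hη.d₂_pos
  have hd₃ := hη.d₃_pos
  have hd₄ := hη.d₄_pos
  have hd₅ := hη.d₅_pos
  set C1 : ℝ := Real.exp d₅ * (4 * |R| + B / 4) with hC1
  set C2 : ℝ := B * d₂ / (2 * d₁) with hC2
  set C3 : ℝ := B * d₄ / (2 * d₃) with hC3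
  have hC1p : 0 < C1 := by positivity
  have hC2p : 0 < C2 := by positivity
  have hC3p : 0 < C3 := by positivity
  refine ⟨C1 + C2 + C3, by positivity, ε₀, hε₀, ?_⟩
  intro ε hε t ht
  have hε0 : 0 < ε := hε.1
  obtain ⟨hEL, ⟨hN1, hN2⟩, ⟨hzero, -, -, hbd⟩, hsm, hεt⟩ :=
    hall (y := ε) (by rw [Real.dist_eq, sub_zero, abs_of_pos hε.1]; exact hε.2) hε.1
  set v := vf ε with hvdef
  have hv : ∀ z ∈ Ioo (-T) T, HasDerivAt v (deriv v z) z := fun z hz =>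
    ((hmin ε hε0).1.1.1 z hz).hasDerivAt
  have hzR : ∀ s, deriv W s + ε * lam ε = 0 → |s| ≤ |R| := by
    intro s hs
    by_contra hcon
    push Not at hcon
    have h1 := hR s ((le_abs_self R).trans hcon.le)
    have h2 : deriv W s = -(ε * lam ε) := by linarith
    rw [h2, abs_neg] at h1
    linarith [min_le_left L 1]
  have haE := abs_le.1 (hzR (aE ε) ((hzero _).2 (Or.inl rfl)))
  have hbE := abs_le.1 (hzR (bE ε) ((hzero _).2 (Or.inr (Or.inr rfl))))
  have hvR : ∀ z ∈ Ioo (-T) T, v z ∈ Icc (-|R|) |R| := fun z hz =>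
    ⟨haE.1.trans (hbd z hz).1, (hbd z hz).2.trans hbE.2⟩
  have hF : ∀ z ∈ Ioo (-T) T, |deriv W (v z) + ε * lam ε| ≤ B := by
    intro z hz
    have h1 := hB₀ _ (hvR z hz)
    have h2 := abs_add_le (deriv W (v z)) (ε * lam ε)
    have h3 := le_abs_self B₀
    have h4 := min_le_right L 1
    linarith
  have hopen : IsOpen (Ioo (-T) T) := isOpen_Ioo
  have hηd : ∀ z ∈ Ioo (-T) T, DifferentiableAt ℝ η z := fun z hz =>
    (hη.smooth.differentiableOn (by norm_num)).differentiableAt (hopen.mem_nhds hz)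
  have hηc : ∀ z ∈ Ioo (-T) T, ContinuousAt η z := fun z hz => (hηd z hz).continuousAt
  have hηp := hη.pos
  set Z : Set ℝ := {aE ε, cE ε, bE ε} with hZdef
  have hZf : Z.Finite := Set.toFinite _
  set M : ℝ := B / (2 * ε ^ 2) with hM
  have hMp : 0 < M := by positivity
  have hp : ∀ z ∈ Ioo (-T) T, v z ∉ Z →
      ∃ p', HasDerivAt (fun s => deriv v s * η s) p' z ∧ |p'| ≤ M * η z := by
    intro z hz hzZ
    have h0 := hηp z hz
    have hE := hEL z hz
    refine ⟨deriv (fun s => deriv v s * η s) z, ?_, ?_⟩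
    · apply DifferentiableAt.hasDerivAt
      by_contra hnd
      rw [deriv_zero_of_not_differentiableAt hnd] at hE
      have h1 : (deriv W (v z) + ε * lam ε) * η z = 0 := by linarith
      have h2 := (mul_eq_zero.1 h1).resolve_right h0.ne'
      exact hzZ ((hzero _).1 h2)
    · have h1 : deriv (fun s => deriv v s * η s) z
          = (deriv W (v z) + ε * lam ε) * η z / (2 * ε ^ 2) := by
        rw [eq_div_iff (by positivity)]
        linarith
      rw [h1, abs_div, abs_mul, abs_of_pos h0, abs_of_pos (show 0 < 2 * ε ^ 2 by positivity), hM,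
        div_mul_eq_mul_div]
      have := hF z hz
      gcongr
  by_cases hl : t + T < ε
  · -- left boundary layer
    have hx : 0 < t + T := by linarith [ht.1]
    have htail : ∀ z ∈ Ioc (-T) t, z ∈ Ioo (-T) T ∧ z ∈ Ioc (-T) (-T + tstar) := fun z hz =>
      ⟨⟨hz.1, lt_of_le_of_lt hz.2 ht.2⟩, hz.1, by linarith [hz.2]⟩
    have h := GB_bdry v (deriv v) η Z hZf (-T) t M (d₂ / d₁) hMp.le (by positivity) ht.1
      (fun z hz => hv z (htail z hz).1) (fun z hz => hηc z (htail z hz).1)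
      (fun z hz => hηp z (htail z hz).1)
      (fun z hz => by
        have h1 := (hη.tail₁ z (htail z hz).2).2
        have h2 := (hη.tail₁ t (htail t ⟨ht.1, le_rfl⟩).2).1
        have h3 : (z + T) ^ (n₁ - 1) ≤ (t + T) ^ (n₁ - 1) :=
          pow_le_pow_left₀ (by linarith [hz.1]) (by linarith [hz.2]) _
        calc η z ≤ d₂ * (t + T) ^ (n₁ - 1) := h1.trans (by gcongr)
          _ = d₂ / d₁ * (d₁ * (t + T) ^ (n₁ - 1)) := by field_simp
          _ ≤ d₂ / d₁ * η t := by gcongr)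
      (fun z hz => hp z ⟨hz.1, hz.2.trans ht.2⟩) hN1
    calc |deriv v t| ≤ M * (d₂ / d₁) * (t - -T) := h
      _ ≤ M * (d₂ / d₁) * ε := by gcongr; linarith
      _ = C2 / ε := by rw [hM, hC2]; field_simp
      _ ≤ (C1 + C2 + C3) / ε := by gcongr; linarith
  by_cases hr : T - t < ε
  · have hx : 0 < T - t := by linarith [ht.2]
    have htail : ∀ z ∈ Ico t T, z ∈ Ioo (-T) T ∧ z ∈ Ico (T - tstar) T := fun z hz =>
      ⟨⟨lt_of_lt_of_le ht.1 hz.1, hz.2⟩, by linarith [hz.1], hz.2⟩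
    have h := GB_bdry_right v (deriv v) η Z hZf T t M (d₄ / d₃) hMp.le (by positivity) ht.2
      (fun z hz => hv z (htail z hz).1) (fun z hz => hηc z (htail z hz).1)
      (fun z hz => hηp z (htail z hz).1)
      (fun z hz => by
        have h1 := (hη.tail₂ z (htail z hz).2).2
        have h2 := (hη.tail₂ t (htail t ⟨le_rfl, ht.2⟩).2).1
        have h3 : (T - z) ^ (n₂ - 1) ≤ (T - t) ^ (n₂ - 1) :=
          pow_le_pow_left₀ (by linarith [hz.2]) (by linarith [hz.1]) _
        calc η z ≤ d₄ * (T - t) ^ (n₂ - 1) := h1.trans (by gcongr)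
          _ = d₄ / d₃ * (d₃ * (T - t) ^ (n₂ - 1)) := by field_simp
          _ ≤ d₄ / d₃ * η t := by gcongr)
      (fun z hz => hp z ⟨ht.1.trans hz.1, hz.2⟩) hN2
    calc |deriv v t| ≤ M * (d₄ / d₃) * (T - t) := h
      _ ≤ M * (d₄ / d₃) * ε := by gcongr
      _ = C3 / ε := by rw [hM, hC3]; field_simp
      _ ≤ (C1 + C2 + C3) / ε := by gcongr; linarith
  · push Not at hl hr
    have hin : ∀ z ∈ Icc (t - ε / 2) t, z ∈ Ioo (-T) T := fun z hz =>
      ⟨by linarith [hz.1], lt_of_le_of_lt hz.2 ht.2⟩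
    have h := GB_interior v (deriv v) η Z hZf (t - ε / 2) t M (Real.exp d₅) (2 * |R|) hMp.le
      (by positivity) (by linarith)
      (fun z hz => hv z (hin z hz)) (fun z hz => hηc z (hin z hz)) (fun z hz => hηp z (hin z hz))
      (fun z hz => by
        have hsub : ∀ u ∈ Icc z t, u ∈ Icc (t - ε / 2) t := fun u hu => ⟨hz.1.trans hu.1, hu.2⟩
        have h1 := GB_eta_ratio η z t (2 * d₅ / ε) (fun u hu => hηd u (hin u (hsub u hu)))
          (fun u hu => hηp u (hin u (hsub u hu)))
          (fun u hu => by
            have h2 := hη.deriv_bound u (hin u (hsub u hu))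
            have h3 := hηp u (hin u (hsub u hu))
            have h4 : ε / 2 ≤ min (T - u) (u + T) :=
              le_min (by linarith [hu.2]) (by linarith [(hsub u hu).1])
            calc |deriv η u| ≤ d₅ * η u / min (T - u) (u + T) := h2
              _ ≤ d₅ * η u / (ε / 2) := by gcongr
              _ = 2 * d₅ / ε * η u := by field_simp) hz.2
        refine h1.trans ?_
        have h5 := hηp t ht
        gcongr
        calc 2 * d₅ / ε * (t - z) ≤ 2 * d₅ / ε * (ε / 2) := by gcongr; linarith [hz.1]
          _ = d₅ := by field_simp)
      (fun z hz => hp z (hin z ⟨hz.1.le, hz.2.le⟩))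
      (by
        have h1 := hvR t ht
        have h2 := hvR (t - ε / 2) (hin _ ⟨le_rfl, by linarith⟩)
        rw [abs_le]
        constructor <;> linarith [h1.1, h1.2, h2.1, h2.2])
    calc |deriv v t| ≤ _ := h
      _ = C1 / ε := by rw [hM, hC1, sub_sub_cancel]; field_simp; ring
      _ ≤ (C1 + C2 + C3) / ε := by gcongr; linarith
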